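/- Let Γ be a finite generalized layered graph with a unique minimal vertex * with |*| = 0. Let v,w ∈ V_+ and k,l be integers with 1 ≤ k ≤ |v|, 1 ≤ l ≤ |w|, and (v,k) ⋗ (w,l), i.e., there is a directed path from v to w and k = |v| − |w|. Then e(v,k)e(w,l) ≡ e(v,k+l) (mod A(Γ)_{f(|v|,k+l)−1}), i.e., e(v,k)e(w,l) − e(v,k+l) lies in the filtration subspace A(Γ)_{f(|v|,k+l)−1}. -/

import Mathlib

open scoped BigOperators

namespace GLG

variable {V E : Type}

def len (tl hd : E → V) (rk : V → ℕ) (e : E) : ℕ := rk (tl e) - rk (hd e)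
def IsRank (tl hd : E → V) (rk : V → ℕ) : Prop := ∀ e : E, rk (hd e) < rk (tl e)
def IsPathC (tl hd : E → V) (e : E) (es : List E) : Prop :=
  List.Chain (fun a b => hd a = tl b) e es
def pathDst (hd : E → V) (e : E) (es : List E) : V :=
  hd ((e :: es).getLast (List.cons_ne_nil e es))
def Reaches (tl hd : E → V) (v w : V) : Prop :=
  ∃ (e : E) (es : List E), IsPathC tl hd e es ∧ tl e = v ∧ pathDst hd e es = w

/-- The set `E^♯` of generators `a_i(e)`, `1 ≤ i ≤ l(e)`. -/
abbrev ESharp (tl hd : E → V) (rk : V → ℕ) : Type :=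
  Σ e : E, {i : ℕ // 1 ≤ i ∧ i ≤ len tl hd rk e}

/-- `P_e(t) = 1 + Σ_{j=1}^{l(e)} (-1)^j a_j(e) t^j`. -/
noncomputable def Pe (F : Type) [Field F] (tl hd : E → V) (rk : V → ℕ) (e : E) :
    Polynomial (FreeAlgebra F (ESharp tl hd rk)) :=
  1 + ∑ j ∈ (Finset.Icc 1 (len tl hd rk e)).attach,
      Polynomial.C ((-1 : FreeAlgebra F (ESharp tl hd rk)) ^ (j : ℕ) *
        FreeAlgebra.ι F (⟨e, ⟨(j : ℕ), (Finset.mem_Icc.mp j.2).1, (Finset.mem_Icc.mp j.2).2⟩⟩ :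
          ESharp tl hd rk)) *
      Polynomial.X ^ (j : ℕ)

/-- `e(π, j)`, the coefficient of `(-t)^j` in `P_π(t) = P_{e₁}(t) ⋯ P_{e_r}(t)`,
for `π` the path given by the list of edges `es`. -/
noncomputable def eP (F : Type) [Field F] (tl hd : E → V) (rk : V → ℕ)
    (es : List E) (j : ℕ) : FreeAlgebra F (ESharp tl hd rk) :=
  (-1 : FreeAlgebra F (ESharp tl hd rk)) ^ j * ((es.map (Pe F tl hd rk)).prod).coeff j

/-- The defining relations of `A(Γ)`: `e(π₁,j) = e(π₂,j)` for paths `π₁, π₂` with the same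
tail and the same head, and `1 ≤ j ≤ l(π₁)`. -/
def rel (F : Type) [Field F] (tl hd : E → V) (rk : V → ℕ) :
    FreeAlgebra F (ESharp tl hd rk) → FreeAlgebra F (ESharp tl hd rk) → Prop :=
  fun x y => ∃ (e1 : E) (es1 : List E) (e2 : E) (es2 : List E) (j : ℕ),
    IsPathC tl hd e1 es1 ∧ IsPathC tl hd e2 es2 ∧
    tl e1 = tl e2 ∧ pathDst hd e1 es1 = pathDst hd e2 es2 ∧
    1 ≤ j ∧ j ≤ rk (tl e1) - rk (pathDst hd e1 es1) ∧
    x = eP F tl hd rk (e1 :: es1) j ∧ y = eP F tl hd rk (e2 :: es2) j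

/-- The algebra `A(Γ) = T(E^♯)/R`. -/
noncomputable abbrev AGamma (F : Type) [Field F] (tl hd : E → V) (rk : V → ℕ) : Type :=
  RingQuot (rel F tl hd rk)

/-- The canonical projection `T(E^♯) → A(Γ)`. -/
noncomputable def mkA (F : Type) [Field F] (tl hd : E → V) (rk : V → ℕ) :
    FreeAlgebra F (ESharp tl hd rk) →ₐ[F] AGamma F tl hd rk :=
  RingQuot.mkAlgHom F (rel F tl hd rk)

/-- `f(a,j) = ja - j(j-1)/2`. -/
def fN (a j : ℕ) : ℕ := j * a - j * (j - 1) / 2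

/-- The filtration weight `|a_i(e)| = f(|t(e)|, i)` of a generator. -/
def wt (tl hd : E → V) (rk : V → ℕ) (s : ESharp tl hd rk) : ℕ := fN (rk (tl s.1)) s.2.1

/-- The filtration subspace `A(Γ)_n`: the span of the images of the products of generators
of total weight at most `n`. -/
noncomputable def filt (F : Type) [Field F] (tl hd : E → V) (rk : V → ℕ) (n : ℕ) :
    Submodule F (AGamma F tl hd rk) :=
  Submodule.span F {x : AGamma F tl hd rk | ∃ w : List (ESharp tl hd rk),
    (w.map (wt tl hd rk)).sum ≤ n ∧ x = mkA F tl hd rk ((w.map (FreeAlgebra.ι F)).prod)}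

/-- The degree-`n` homogeneous component `A(Γ)_{[n]}` (for the grading with `deg a_i(e) = i`):
the image in `A(Γ)` of the span of the words of total degree `n`. -/
noncomputable def gpiece (F : Type) [Field F] (tl hd : E → V) (rk : V → ℕ) (n : ℕ) :
    Submodule F (AGamma F tl hd rk) :=
  Submodule.span F {x : AGamma F tl hd rk | ∃ w : List (ESharp tl hd rk),
    (w.map (fun s => s.2.1)).sum = n ∧ x = mkA F tl hd rk ((w.map (FreeAlgebra.ι F)).prod)}

/-- The Hilbert series `H(A(Γ), z) = Σ_n dim_F A(Γ)_{[n]} · z^n ∈ ℤ[[z]]`. -/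
noncomputable def hilb (F : Type) [Field F] (tl hd : E → V) (rk : V → ℕ) : PowerSeries ℤ :=
  PowerSeries.mk fun n => (Module.finrank F (gpiece F tl hd rk n) : ℤ)


/-- `v ≥ w` in the poset of the graph. -/
def GE (tl hd : E → V) (v w : V) : Prop := v = w ∨ Reaches tl hd v w

/-- The Möbius function of the poset of the graph: the sum of `(-1)^(l+1)` over all
chains `v = v₁ > v₂ > ⋯ > v_l = w`. -/
noncomputable def mob (tl hd : E → V) (v w : V) : ℤ :=
  ∑ᶠ c ∈ {c : List V | c.Chain' (Reaches tl hd) ∧ c.head? = some v ∧ c.getLast? = some w},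
    (-1 : ℤ) ^ (c.length + 1)

/-- `M(Γ)(z) = Σ_{v ≥ w} μ(v,w) z^{|v|-|w|}`, as a formal power series over `ℤ`. -/
noncomputable def MGamma (tl hd : E → V) (rk : V → ℕ) : PowerSeries ℤ :=
  ∑ᶠ p ∈ {p : V × V | GE tl hd p.1 p.2},
    mob tl hd p.1 p.2 • (PowerSeries.X : PowerSeries ℤ) ^ (rk p.1 - rk p.2)

/-- `M_∘(Γ)(z) = Σ_{x ∈ V} μ(x, v_min) z^{|x|-|v_min|}`. -/
noncomputable def MLow (tl hd : E → V) (rk : V → ℕ) (vmin : V) : PowerSeries ℤ :=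
  ∑ᶠ x : V, mob tl hd x vmin • (PowerSeries.X : PowerSeries ℤ) ^ (rk x - rk vmin)

noncomputable def MUp (tl hd : E → V) (rk : V → ℕ) (vmax : V) : PowerSeries ℤ :=
  ∑ᶠ x : V, mob tl hd vmax x • (PowerSeries.X : PowerSeries ℤ) ^ (rk vmax - rk x)

end GLG

namespace GLG

def PathTo {V E : Type} (tl hd : E → V) : V → List E → V → Prop
  | v, [], w => v = w
  | v, e :: es, w => tl e = v ∧ PathTo tl hd (hd e) es w

section aux
variable (F : Type) [Field F] {V E : Type} (tl hd : E → V) (rk : V → ℕ)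

lemma two_fN (a j : ℕ) (h : j ≤ a) : (2 * fN a j : ℤ) = j * (2 * a - j + 1) := by
  obtain ⟨c, hc⟩ : 2 ∣ j * (j - 1) := (Nat.even_mul_pred_self j).two_dvd
  have h2 : j * (j - 1) / 2 = c := by omega
  have h3 : j * (j - 1) ≤ j * a := Nat.mul_le_mul_left _ (by omega)
  have h4 : c ≤ j * a := by omega
  unfold fN
  rw [h2]
  push_cast [Nat.cast_sub h4]
  rcases j with _ | j
  · simp at hc; subst hc; simp
  · have : ((j + 1 : ℕ) * j : ℤ) = 2 * c := by exact_mod_cast hc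
    push_cast at this ⊢
    linarith

lemma fN_add (a b i j : ℕ) (h : i + b ≤ a) (hj : j ≤ b) :
    (fN a i + fN b j + j * (a - b - i : ℤ) : ℤ) = fN a (i + j) := by
  have h1 := two_fN a i (by omega)
  have h2 := two_fN b j hj
  have h3 := two_fN a (i + j) (by omega)
  push_cast at *
  have : (2 * (fN a i + fN b j + j * (a - b - i : ℤ)) : ℤ) = 2 * fN a (i + j) := by
    rw [h3]; linear_combination h1 + h2
  linarith

lemma fN_add_le (a b i j : ℕ) (h : i + b ≤ a) (hj : j ≤ b) :
    fN a i + fN b j ≤ fN a (i + j) := by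
  have h1 := fN_add a b i j h hj
  have h2 : (0 : ℤ) ≤ j * (a - b - i : ℤ) := by
    apply mul_nonneg <;> omega
  omega

lemma fN_add_lt (a b i j : ℕ) (h : i + b < a) (hj : j ≤ b) (hj0 : 1 ≤ j) :
    fN a i + fN b j < fN a (i + j) := by
  have h1 := fN_add a b i j h.le hj
  have h2 : (0 : ℤ) < j * (a - b - i : ℤ) := by
    apply mul_pos <;> omega
  omega

lemma filt_mono {m n : ℕ} (h : m ≤ n) : filt F tl hd rk m ≤ filt F tl hd rk n := by
  apply Submodule.span_mono
  rintro x ⟨w, hw, rfl⟩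
  exact ⟨w, hw.trans h, rfl⟩

lemma filt_mul {m n : ℕ} {x y : AGamma F tl hd rk} (hx : x ∈ filt F tl hd rk m)
    (hy : y ∈ filt F tl hd rk n) : x * y ∈ filt F tl hd rk (m + n) := by
  have h := Submodule.mul_mem_mul hx hy
  unfold filt at h
  rw [Submodule.span_mul_span] at h
  refine Submodule.span_mono ?_ h
  rintro _ ⟨_, ⟨w, hw, rfl⟩, _, ⟨u, hu, rfl⟩, rfl⟩
  refine ⟨w ++ u, ?_, ?_⟩
  · simp; omega
  · simp

lemma eP_append (es fs : List E) (n : ℕ) : eP F tl hd rk (es ++ fs) n =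
    ∑ p ∈ Finset.HasAntidiagonal.antidiagonal n, eP F tl hd rk es p.1 * eP F tl hd rk fs p.2 := by
  unfold eP
  rw [List.map_append, List.prod_append, Polynomial.coeff_mul, Finset.mul_sum]
  refine Finset.sum_congr rfl fun p hp => ?_
  rw [← Finset.HasAntidiagonal.mem_antidiagonal.mp hp, pow_add]
  have hc : ∀ x : FreeAlgebra F (ESharp tl hd rk), Commute ((-1) ^ p.2) x := fun x =>
    (Commute.neg_one_left x).pow_left _
  rw [mul_assoc, mul_assoc, ← mul_assoc ((-1) ^ p.2), (hc _).eq, mul_assoc]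

lemma eP_nil (n : ℕ) : eP F tl hd rk [] n = if n = 0 then 1 else 0 := by
  unfold eP
  rcases n with _ | n <;> simp [Polynomial.coeff_one]

lemma eP_single_zero (e : E) : eP F tl hd rk [e] 0 = 1 := by
  simp only [eP, Pe, List.map_cons, List.map_nil, List.prod_cons, List.prod_nil, mul_one,
    Polynomial.coeff_add, Polynomial.finsetSum_coeff, Polynomial.coeff_C_mul_X_pow]
  rw [Finset.sum_eq_zero]
  · simp
  · intro j _
    have := (Finset.mem_Icc.mp j.2).1
    rw [if_neg (by omega)]

lemma eP_single (e : E) (n : ℕ) (h : 1 ≤ n ∧ n ≤ len tl hd rk e) :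
    eP F tl hd rk [e] n = FreeAlgebra.ι F (⟨e, ⟨n, h⟩⟩ : ESharp tl hd rk) := by
  simp only [eP, Pe, List.map_cons, List.map_nil, List.prod_cons, List.prod_nil, mul_one,
    Polynomial.coeff_add, Polynomial.finsetSum_coeff, Polynomial.coeff_C_mul_X_pow]
  rw [Finset.sum_eq_single ⟨n, Finset.mem_Icc.mpr h⟩]
  · rw [Polynomial.coeff_one, if_neg (by omega), if_pos rfl, zero_add, ← mul_assoc, ← pow_add,
      Even.neg_one_pow ⟨n, rfl⟩, one_mul]
  · intro b _ hb
    rw [if_neg]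
    intro hn
    exact hb (Subtype.ext hn.symm)
  · simp

lemma eP_single_gt (e : E) (n : ℕ) (h : len tl hd rk e < n) :
    eP F tl hd rk [e] n = 0 := by
  simp only [eP, Pe, List.map_cons, List.map_nil, List.prod_cons, List.prod_nil, mul_one,
    Polynomial.coeff_add, Polynomial.finsetSum_coeff, Polynomial.coeff_C_mul_X_pow]
  rw [Finset.sum_eq_zero]
  · rw [Polynomial.coeff_one, if_neg (by omega)]; simp
  · intro j _
    have := (Finset.mem_Icc.mp j.2).2
    rw [if_neg (by omega)]

lemma eP_zero (es : List E) : eP F tl hd rk es 0 = 1 := by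
  induction es with
  | nil => simp [eP_nil]
  | cons e es ih =>
    rw [← List.singleton_append, eP_append]
    simp [eP_single_zero, ih]

variable {tl hd rk} (hrank : IsRank tl hd rk)
include hrank

lemma PathTo.rk_le {es : List E} {v w : V} (h : PathTo tl hd v es w) : rk w ≤ rk v := by
  induction es generalizing v with
  | nil => cases h; rfl
  | cons e es ih =>
    obtain ⟨rfl, h⟩ := h
    exact (ih h).trans (hrank e).le

lemma PathTo.eP_gt {es : List E} {v w : V} (h : PathTo tl hd v es w) {n : ℕ}
    (hn : rk v - rk w < n) : eP F tl hd rk es n = 0 := by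
  induction es generalizing v n with
  | nil => rw [eP_nil, if_neg (by omega)]
  | cons e es ih =>
    obtain ⟨rfl, h⟩ := h
    have h1 := PathTo.rk_le hrank h
    have h2 := hrank e
    rw [← List.singleton_append, eP_append]
    refine Finset.sum_eq_zero fun p hp => ?_
    have hp := Finset.HasAntidiagonal.mem_antidiagonal.mp hp
    by_cases h3 : len tl hd rk e < p.1
    · rw [eP_single_gt _ _ _ _ _ _ h3, zero_mul]
    · rw [ih h, mul_zero]
      unfold len at h3
      omega

lemma PathTo.eP_mem {es : List E} {v w : V} (h : PathTo tl hd v es w) (n : ℕ) :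
    mkA F tl hd rk (eP F tl hd rk es n) ∈ filt F tl hd rk (fN (rk v) n) := by
  have one_mem : ∀ m, (1 : AGamma F tl hd rk) ∈ filt F tl hd rk m := fun m =>
    Submodule.subset_span ⟨[], by simp, by simp⟩
  induction es generalizing v n with
  | nil =>
    rw [eP_nil]
    split_ifs
    · rw [map_one]; exact one_mem _
    · rw [map_zero]; exact Submodule.zero_mem _
  | cons e es ih =>
    obtain ⟨rfl, h⟩ := h
    have h1 := PathTo.rk_le hrank h
    have h2 := hrank e
    rw [← List.singleton_append, eP_append, map_sum]
    refine Submodule.sum_mem _ fun p hp => ?_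
    have hp := Finset.HasAntidiagonal.mem_antidiagonal.mp hp
    rw [map_mul]
    by_cases h3 : len tl hd rk e < p.1
    · rw [eP_single_gt _ _ _ _ _ _ h3, map_zero, zero_mul]; exact Submodule.zero_mem _
    by_cases h4 : rk (hd e) - rk w < p.2
    · rw [PathTo.eP_gt F hrank h h4, map_zero, mul_zero]; exact Submodule.zero_mem _
    have h5 : mkA F tl hd rk (eP F tl hd rk [e] p.1) ∈
        filt F tl hd rk (fN (rk (tl e)) p.1) := by
      by_cases h6 : p.1 = 0
      · rw [h6, eP_single_zero, map_one]; exact one_mem _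
      · rw [eP_single _ _ _ _ _ _ ⟨by omega, by omega⟩]
        refine Submodule.subset_span ⟨[⟨e, ⟨p.1, by omega, by omega⟩⟩], ?_, by simp⟩
        simp [wt]
    refine filt_mono F tl hd rk ?_ (filt_mul F tl hd rk h5 (ih h p.2))
    rw [← hp]
    unfold len at h3
    exact fN_add_le _ _ _ _ (by omega) (by omega)

omit hrank in
lemma PathTo.isPathC {e : E} {es : List E} {v w : V} (h : PathTo tl hd v (e :: es) w) :
    IsPathC tl hd e es ∧ tl e = v ∧ pathDst hd e es = w := by
  induction es generalizing e v with
  | nil =>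
    obtain ⟨h1, h2⟩ := h
    exact ⟨List.isChain_singleton _, h1, h2⟩
  | cons f es ih =>
    obtain ⟨h1, h2⟩ := h
    obtain ⟨h3, h4, h5⟩ := ih h2
    refine ⟨List.isChain_cons_cons.mpr ⟨h4.symm, h3⟩, h1, ?_⟩
    rw [← h5]
    simp [pathDst]

omit hrank in
lemma PathTo.of_isPathC {e : E} {es : List E} (h : IsPathC tl hd e es) :
    PathTo tl hd (tl e) (e :: es) (pathDst hd e es) := by
  induction es generalizing e with
  | nil => exact ⟨rfl, rfl⟩
  | cons f es ih =>
    obtain ⟨h1, h2⟩ := List.isChain_cons_cons.mp h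
    refine ⟨rfl, ?_⟩
    have := ih h2
    rw [h1]
    simpa [pathDst] using this

omit hrank in
lemma PathTo.append {es fs : List E} {u v w : V} (h : PathTo tl hd u es v)
    (h' : PathTo tl hd v fs w) : PathTo tl hd u (es ++ fs) w := by
  induction es generalizing u with
  | nil => cases h; exact h'
  | cons e es ih => exact ⟨h.1, ih h.2⟩

lemma PathTo.eP_eq {es fs : List E} {v w : V} (h : PathTo tl hd v es w)
    (h' : PathTo tl hd v fs w) (hes : es ≠ []) (hfs : fs ≠ []) (n : ℕ) :
    mkA F tl hd rk (eP F tl hd rk es n) = mkA F tl hd rk (eP F tl hd rk fs n) := by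
  by_cases h0 : n = 0
  · rw [h0, eP_zero, eP_zero]
  by_cases h1 : rk v - rk w < n
  · rw [PathTo.eP_gt F hrank h h1, PathTo.eP_gt F hrank h' h1]
  rcases es with _ | ⟨e, es⟩
  · exact absurd rfl hes
  rcases fs with _ | ⟨f, fs⟩
  · exact absurd rfl hfs
  obtain ⟨a1, a2, a3⟩ := h.isPathC
  obtain ⟨b1, b2, b3⟩ := h'.isPathC
  apply RingQuot.mkAlgHom_rel
  exact ⟨e, es, f, fs, n, a1, b1, a2.trans b2.symm, a3.trans b3.symm, by omega,
    by rw [a2, a3]; omega, rfl, rfl⟩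

end aux

end GLG

/-- **Proposition 2.2.** Let `Γ` be a finite generalized layered graph with a
unique minimal vertex `*` with `|*| = 0`, and let `e(v,j)` be defined from the fixed paths
`π_v` as in the paper.  If `v, w ∈ V₊`, `1 ≤ k ≤ |v|`, `1 ≤ l ≤ |w|` and `(v,k) ⋗ (w,l)`
(i.e. there is a directed path from `v` to `w` and `k = |v| - |w|`), then
`e(v,k)·e(w,l) ≡ e(v,k+l)` modulo the filtration subspace `A(Γ)_{f(|v|, k+l) - 1}`. -/
theorem eV_mul_eV_congr (F : Type) [Field F] {V E : Type} [Fintype V] [Fintype E]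
    (tl hd : E → V) (rk : V → ℕ) (hrank : GLG.IsRank tl hd rk)
    (star : V) (hstar0 : rk star = 0)
    (hmin : ∀ v : V, (∀ e : E, tl e ≠ v) ↔ v = star)
    (sel : V → E) (hsel : ∀ v : V, v ≠ star → tl (sel v) = v)
    (pathOf : V → List E)
    (hpathOf0 : pathOf star = [])
    (hpathOfS : ∀ v : V, v ≠ star → pathOf v = sel v :: pathOf (hd (sel v)))
    (v w : V) (hv : v ≠ star) (hw : w ≠ star)
    (k l : ℕ) (hk1 : 1 ≤ k) (hk2 : k ≤ rk v) (hl1 : 1 ≤ l) (hl2 : l ≤ rk w)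
    (hcov : GLG.Reaches tl hd v w ∧ k = rk v - rk w) :
    GLG.mkA F tl hd rk (GLG.eP F tl hd rk (pathOf v) k) *
          GLG.mkA F tl hd rk (GLG.eP F tl hd rk (pathOf w) l) -
        GLG.mkA F tl hd rk (GLG.eP F tl hd rk (pathOf v) (k + l)) ∈
      GLG.filt F tl hd rk (GLG.fN (rk v) (k + l) - 1) := by
  obtain ⟨⟨e, es, hpath, hve, hwd⟩, hk⟩ := hcov
  have hp := GLG.PathTo.of_isPathC hpath
  rw [hve, hwd] at hp
  have hpo : ∀ n, ∀ u, rk u = n → GLG.PathTo tl hd u (pathOf u) star := by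
    intro n
    induction n using Nat.strong_induction_on with
    | _ n ih =>
      intro u hu
      by_cases hus : u = star
      · subst hus; rw [hpathOf0]; rfl
      · rw [hpathOfS u hus]
        refine ⟨hsel u hus, ih (rk (hd (sel u))) ?_ _ rfl⟩
        have := hrank (sel u)
        rw [hsel u hus] at this
        omega
  have hpv := hpo _ v rfl
  have hpw := hpo _ w rfl
  set π := e :: es with hπ
  have heq : ∀ n, GLG.mkA F tl hd rk (GLG.eP F tl hd rk (pathOf v) n) =
      ∑ p ∈ Finset.HasAntidiagonal.antidiagonal n, GLG.mkA F tl hd rk (GLG.eP F tl hd rk π p.1) *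
        GLG.mkA F tl hd rk (GLG.eP F tl hd rk (pathOf w) p.2) := by
    intro n
    rw [GLG.PathTo.eP_eq F hrank hpv (hp.append hpw) (by rw [hpathOfS v hv]; simp)
      (by simp [hπ]) n, GLG.eP_append, map_sum]
    simp
  have hmem := fun n => GLG.PathTo.eP_mem F hrank hp n
  have hmemw := fun n => GLG.PathTo.eP_mem F hrank hpw n
  have hgt := fun n hn => GLG.PathTo.eP_gt F hrank (n := n) hp hn
  have hgtw := fun n hn => GLG.PathTo.eP_gt F hrank (n := n) hpw hn
  rw [heq k, heq (k + l)]
  rw [← Finset.add_sum_erase _ _ (show (k, 0) ∈ Finset.HasAntidiagonal.antidiagonal k by simp),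
    ← Finset.add_sum_erase _ _ (show (k, l) ∈ Finset.HasAntidiagonal.antidiagonal (k + l) by simp)]
  simp only [GLG.eP_zero, map_one, mul_one]
  rw [add_mul, add_sub_add_left_eq_sub, Finset.sum_mul]
  refine Submodule.sub_mem _ (Submodule.sum_mem _ fun p hp' => ?_)
    (Submodule.sum_mem _ fun p hp' => ?_)
  · obtain ⟨hne, hp1⟩ := Finset.mem_erase.mp hp'
    have hp1 := Finset.HasAntidiagonal.mem_antidiagonal.mp hp1
    have hlt : p.1 < k := by
      rcases Nat.lt_or_ge p.1 k with h | h
      · exact h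
      · exact absurd (Prod.ext (by simp; omega) (by simp; omega)) hne
    by_cases h2 : rk w < p.2
    · rw [hgtw p.2 (by omega), map_zero, mul_zero, zero_mul]; exact Submodule.zero_mem _
    refine GLG.filt_mono F tl hd rk ?_ (GLG.filt_mul F tl hd rk
      (GLG.filt_mul F tl hd rk (hmem p.1) (hmemw p.2)) (hmemw l))
    have a1 := GLG.fN_add_lt (rk v) (rk w) p.1 p.2 (by omega) (by omega) (by omega)
    have a2 := GLG.fN_add_le (rk v) (rk w) k l (by omega) (by omega)
    rw [hp1] at a1
    omega
  · obtain ⟨hne, hp1⟩ := Finset.mem_erase.mp hp'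
    have hp1 := Finset.HasAntidiagonal.mem_antidiagonal.mp hp1
    by_cases h1 : k < p.1
    · rw [hgt p.1 (by omega), map_zero, zero_mul]; exact Submodule.zero_mem _
    have hlt : p.1 < k := by
      rcases Nat.lt_or_ge p.1 k with h | h
      · exact h
      · exact absurd (Prod.ext (by simp; omega) (by simp; omega)) hne
    by_cases h2 : rk w < p.2
    · rw [hgtw p.2 (by omega), map_zero, mul_zero]; exact Submodule.zero_mem _
    refine GLG.filt_mono F tl hd rk ?_ (GLG.filt_mul F tl hd rk (hmem p.1) (hmemw p.2))
    have a1 := GLG.fN_add_lt (rk v) (rk w) p.1 p.2 (by omega) (by omega) (by omega)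
    rw [hp1] at a1
    omega
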